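/- Let A and B be simple unital complex C*-algebras, φ : GL(A) → GL(B) a group isomorphism, and θ the induced map on idempotents. Let e ∈ Ĩ(A) be a nontrivial idempotent with coefficient maps (a_e, b_e), and set c_e(λ) = a_e(λ) b_e(λ)⁻¹. Then: (i) if f ∈ Ĩ(A) has coefficient maps (a_f, b_f) and f = u e u⁻¹ for some u ∈ GL(A), then c_e(λ) = c_f(λ) for all nonzero λ; (ii) c_e(λ)² ≠ 1 for every λ ∈ ℂ∖{−1, 0, 1}; (iii) if (a', b') are coefficient maps for the idempotent 1 − e, then c_e(λ) = a'(λ) b'(λ)⁻¹ for all nonzero λ. -/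

import Mathlib

noncomputable section

/-- The symmetry `1 - 2e` associated to an idempotent `e` is a unit (its own inverse). -/
def symUnit {A : Type*} [Ring A] {e : A} (he : IsIdempotentElem e) : Aˣ where
  val := 1 - 2 * e
  inv := 1 - 2 * e
  val_inv := by
    have h : e * e = e := he
    have expand : (1 - 2 * e) * (1 - 2 * e) = 1 - 4 * e + 4 * (e * e) := by noncomm_ring
    rw [expand, h]; noncomm_ring
  inv_val := by
    have h : e * e = e := he
    have expand : (1 - 2 * e) * (1 - 2 * e) = 1 - 4 * e + 4 * (e * e) := by noncomm_ring
    rw [expand, h]; noncomm_ring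

/-- The map `θ_φ` induced on idempotents by a map `φ` between the groups of invertible
elements, determined by `1 - 2 θ_φ(e) = φ(1 - 2e)`, i.e. `θ_φ(e) = (1 - φ(1 - 2e))/2`;
it is extended by `0` off the set of idempotents. -/
noncomputable def theta {A B : Type*} [Ring A] [Ring B] [Algebra ℂ B]
    (φ : Aˣ → Bˣ) (e : A) : B :=
  letI := Classical.propDecidable (IsIdempotentElem e)
  if h : IsIdempotentElem e then (2 : ℂ)⁻¹ • ((1 : B) - (φ (symUnit h) : B)) else 0

/-- `a` and `b` are coefficient maps for the idempotent `e` (w.r.t. `φ`):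
`φ(λe + 1 - e) = a(λ) θ(e) + b(λ) θ(1-e)` for all nonzero `λ`. -/
def IsCoeffMaps {A B : Type*} [Ring A] [Ring B] [Algebra ℂ A] [Algebra ℂ B]
    (φ : Aˣ → Bˣ) (e : A) (a b : ℂˣ →* ℂˣ) : Prop :=
  ∀ (lam : ℂˣ) (v : Aˣ), (v : A) = (lam : ℂ) • e + 1 - e →
    (φ v : B) = ((a lam : ℂˣ) : ℂ) • theta φ e + ((b lam : ℂˣ) : ℂ) • theta φ (1 - e)

/-- `c(λ) = a(λ) b(λ)⁻¹`, as an element of `ℂˣ`. -/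
def cOf (a b : ℂˣ →* ℂˣ) (lam : ℂˣ) : ℂˣ := a lam * (b lam)⁻¹

variable {A B : Type*}
  [NormedRing A] [StarRing A] [CStarRing A] [CompleteSpace A]
  [NormedAlgebra ℂ A] [StarModule ℂ A]
  [NormedRing B] [StarRing B] [CStarRing B] [CompleteSpace B]
  [NormedAlgebra ℂ B] [StarModule ℂ B]


/-- A central idempotent of a simple ring is trivial. -/
lemma IsIdempotentElem.eq_zero_or_one_of_central {R : Type*} [Ring R] [IsSimpleRing R] {p : R}
    (hp : IsIdempotentElem p) (hc : ∀ y, Commute p y) : p = 0 ∨ p = 1 := by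
  have hmem : p ∈ Subring.center R := Subring.mem_center_iff.2 fun y => (hc y).eq.symm
  have hmul : (⟨p, hmem⟩ : Subring.center R) * ((⟨p, hmem⟩ : Subring.center R) - 1) = 0 := by
    ext
    simp [mul_sub, hp.eq]
  rcases (IsSimpleRing.isField_center R).isDomain.to_noZeroDivisors.eq_zero_or_eq_zero_of_mul_eq_zero
    hmul with h | h
  · exact Or.inl (congrArg Subtype.val h)
  · refine Or.inr (sub_eq_zero.1 ?_)
    simpa using congrArg Subtype.val h

/-- In a simple algebra, a linear combination of a nontrivial idempotent and its complement is
central only if it is scalar. -/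
lemma IsIdempotentElem.eq_of_smul_add_smul_central {R : Type*} [Ring R] [Algebra ℂ R]
    [IsSimpleRing R] {p : R} (hp : IsIdempotentElem p) (hp0 : p ≠ 0) (hp1 : p ≠ 1) {α β : ℂ}
    (hc : ∀ y, Commute (α • p + β • (1 - p)) y) : α = β := by
  by_contra hne
  have hsub : α - β ≠ 0 := sub_ne_zero.2 hne
  have hpc : ∀ y, Commute p y := by
    intro y
    have hx : p = (α - β)⁻¹ • ((α • p + β • (1 - p)) - β • (1 : R)) := by
      rw [eq_inv_smul_iff₀ hsub]
      module
    rw [hx]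
    exact ((hc y).sub_left ((Commute.one_left y).smul_left β)).smul_left _
  rcases hp.eq_zero_or_one_of_central hpc with h | h
  exacts [hp0 h, hp1 h]

/-- An element commuting with every unit of a complex Banach algebra is central. -/
lemma commute_of_forall_units {R : Type*} [NormedRing R] [NormedAlgebra ℂ R] [CompleteSpace R]
    {x : R} (hx : ∀ u : Rˣ, Commute x u) (y : R) : Commute x y := by
  obtain ⟨r, hr⟩ : ∃ r : ℂ, r ∈ resolventSet ℂ y := by
    refine ⟨((‖y‖ * ‖(1 : R)‖ + 1 : ℝ) : ℂ), spectrum.mem_resolventSet_of_norm_lt_mul ?_⟩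
    rw [Complex.norm_real, Real.norm_of_nonneg (by positivity)]
    linarith
  have h := hx (IsUnit.unit hr)
  change Commute x (algebraMap ℂ R r - y) at h
  simpa using (Algebra.commute_algebraMap_right r x).sub_right h

/-- A group isomorphism between unit groups of complex Banach algebras preserves central units. -/
lemma commute_map_of_central {R S : Type*} [Monoid R] [NormedRing S] [NormedAlgebra ℂ S]
    [CompleteSpace S] (φ : Rˣ ≃* Sˣ) {u : Rˣ} (hu : ∀ y : R, Commute (u : R) y) (y : S) :
    Commute (φ u : S) y := by
  refine commute_of_forall_units (fun w => ?_) y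
  obtain ⟨v, rfl⟩ := φ.surjective w
  have huv : u * v = v * u := Units.ext (hu v).eq
  have h := congrArg φ huv
  rw [map_mul, map_mul] at h
  exact congrArg Units.val h

/-- If `z` is an involution, then `(1 - z) / 2` is idempotent. -/
lemma isIdempotentElem_half_one_sub {R : Type*} [Ring R] [Algebra ℂ R] {z : R} (hz : z * z = 1) :
    IsIdempotentElem ((2 : ℂ)⁻¹ • (1 - z)) := by
  have hsq : (1 - z) * (1 - z) = (2 : ℂ) • (1 - z) := by
    rw [two_smul, mul_sub, mul_one, sub_mul, one_mul, hz]
    abel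
  rw [IsIdempotentElem, smul_mul_smul_comm, hsq, smul_smul]
  norm_num

/-- If a unit of a simple complex algebra is a central involution, it is `1` or `-1`. -/
lemma eq_one_or_neg_one_of_central {R : Type*} [Ring R] [Algebra ℂ R] [IsSimpleRing R] {z : R}
    (hz : z * z = 1) (hc : ∀ y, Commute z y) : z = 1 ∨ z = -1 := by
  rcases (isIdempotentElem_half_one_sub hz).eq_zero_or_one_of_central
    (fun y => (((Commute.one_left y).sub_left (hc y)).smul_left _)) with h | h
  · left
    rw [inv_smul_eq_iff₀ two_ne_zero, smul_zero] at h
    exact (sub_eq_zero.1 h).symm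
  · right
    rw [inv_smul_eq_iff₀ two_ne_zero, two_smul, sub_eq_iff_eq_add, add_assoc, left_eq_add] at h
    exact (neg_eq_of_add_eq_zero_right h).symm

/-- The unit `λe + 1 - e` associated to an idempotent `e` and a nonzero scalar `λ`. -/
def idemUnit {R : Type*} [Ring R] [Algebra ℂ R] {e : R} (he : IsIdempotentElem e) (lam : ℂˣ) :
    Rˣ where
  val := (lam : ℂ) • e + 1 - e
  inv := ((lam⁻¹ : ℂˣ) : ℂ) • e + 1 - e
  val_inv := by
    simp only [mul_sub, sub_mul, add_mul, mul_add, smul_mul_assoc, mul_smul_comm, he.eq, mul_one,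
      one_mul]
    rw [add_sub_cancel_right, smul_smul, Units.inv_mul, one_smul]
    abel
  inv_val := by
    simp only [mul_sub, sub_mul, add_mul, mul_add, smul_mul_assoc, mul_smul_comm, he.eq, mul_one,
      one_mul]
    rw [add_sub_cancel_right, smul_smul, Units.mul_inv, one_smul]
    abel

lemma idemUnit_mul_one_sub {R : Type*} [Ring R] [Algebra ℂ R] {e : R} (he : IsIdempotentElem e)
    (lam : ℂˣ) : ((idemUnit he lam * idemUnit he.one_sub lam : Rˣ) : R) = (lam : ℂ) • 1 := by
  simp only [idemUnit, Units.val_mul, mul_sub, sub_mul, add_mul, smul_sub,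
    mul_add, smul_mul_assoc, mul_smul_comm, he.eq, mul_one, one_mul]
  module

/-- If `λe + 1 - e` is central, where `e` is nontrivial, then `λ = 1`. -/
lemma eq_one_of_idemUnit_central {R : Type*} [Ring R] [Algebra ℂ R] [IsSimpleRing R] {e : R}
    (he : IsIdempotentElem e) (he0 : e ≠ 0) (he1 : e ≠ 1) {lam : ℂˣ}
    (hc : ∀ y, Commute (idemUnit he lam : R) y) : (lam : ℂ) = 1 := by
  refine he.eq_of_smul_add_smul_central he0 he1 (β := 1) fun y => ?_
  have h : (lam : ℂ) • e + (1 : ℂ) • (1 - e) = (idemUnit he lam : R) := by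
    simp only [idemUnit]
    module
  rw [h]
  exact hc y

/-- The coefficients of a linear combination of a nontrivial idempotent and its complement are
unique. -/
lemma IsIdempotentElem.smul_add_smul_inj {R : Type*} [Ring R] [Algebra ℂ R] {p : R}
    (hp : IsIdempotentElem p) (hp0 : p ≠ 0) (hp1 : p ≠ 1) {α β γ δ : ℂ}
    (h : α • p + β • (1 - p) = γ • p + δ • (1 - p)) : α = γ ∧ β = δ := by
  have h1 := congrArg (fun x => x * p) h
  have h2 := congrArg (fun x => x * (1 - p)) h
  simp only [add_mul, smul_mul_assoc, hp.eq, hp.one_sub_mul_self, hp.mul_one_sub_self,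
    hp.one_sub.eq, smul_zero, add_zero, zero_add] at h1 h2
  exact ⟨smul_left_injective ℂ hp0 h1, smul_left_injective ℂ (sub_ne_zero.2 hp1.symm) h2⟩

lemma theta_of_isIdempotentElem {R S : Type*} [Ring R] [Ring S] [Algebra ℂ S] (φ : Rˣ → Sˣ) {e : R}
    (he : IsIdempotentElem e) :
    theta φ e = (2 : ℂ)⁻¹ • ((1 : S) - (φ (symUnit he) : S)) := by
  rw [theta, dif_pos he]

lemma symUnit_mul_self {R : Type*} [Ring R] {e : R} (he : IsIdempotentElem e) :
    symUnit he * symUnit he = 1 :=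
  Units.ext (symUnit he).val_inv

lemma symUnit_one_sub {R : Type*} [Ring R] {e : R} (he : IsIdempotentElem e) :
    symUnit he.one_sub = -1 * symUnit he := by
  ext
  simp only [symUnit, Units.val_mul, Units.val_neg, Units.val_one]
  noncomm_ring

lemma isIdempotentElem_theta {R S : Type*} [Ring R] [Ring S] [Algebra ℂ S] (φ : Rˣ ≃* Sˣ) {e : R}
    (he : IsIdempotentElem e) : IsIdempotentElem (theta φ e) := by
  have hz : (φ (symUnit he) : S) * φ (symUnit he) = 1 := by
    rw [← Units.val_mul, ← map_mul, symUnit_mul_self, map_one, Units.val_one]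
  rw [theta_of_isIdempotentElem φ he]
  exact isIdempotentElem_half_one_sub hz

lemma theta_ne_zero {R S : Type*} [Ring R] [Algebra ℂ R] [Ring S] [Algebra ℂ S]
    (φ : Rˣ ≃* Sˣ) {e : R} (he : IsIdempotentElem e)
    (he0 : e ≠ 0) : theta φ e ≠ 0 := by
  intro h
  rw [theta_of_isIdempotentElem φ he, inv_smul_eq_iff₀ two_ne_zero, smul_zero, sub_eq_zero] at h
  have h1 : φ (symUnit he) = φ 1 := by
    rw [map_one]
    exact Units.ext h.symm
  have h2 := congrArg Units.val (φ.injective h1)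
  simp only [symUnit, Units.val_one, sub_eq_self, two_mul, ← two_smul ℂ e] at h2
  exact smul_ne_zero two_ne_zero he0 h2

lemma theta_conj {R S : Type*} [Ring R] [Ring S] [Algebra ℂ S] (φ : Rˣ ≃* Sˣ) {e f : R}
    (he : IsIdempotentElem e) (hf : IsIdempotentElem f) (u : Rˣ)
    (hfu : f = (u : R) * e * ((u⁻¹ : Rˣ) : R)) :
    theta φ f = (φ u : S) * theta φ e * ((φ u)⁻¹ : Sˣ) := by
  have hs : symUnit hf = u * symUnit he * u⁻¹ := by
    ext
    simp only [symUnit, Units.val_mul, hfu, two_mul, mul_sub, sub_mul, mul_add, add_mul, mul_one,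
      Units.mul_inv]
  rw [theta_of_isIdempotentElem φ he, theta_of_isIdempotentElem φ hf, hs, map_mul, map_mul, map_inv]
  simp only [mul_smul_comm, smul_mul_assoc, mul_sub, sub_mul, mul_one, Units.val_mul, Units.mul_inv]

section Theta

variable {R S : Type*} [Ring R] [Algebra ℂ R] [IsSimpleRing R] [NormedRing S] [NormedAlgebra ℂ S]
  [CompleteSpace S] [IsSimpleRing S]

lemma map_neg_one_of_isSimpleRing (φ : Rˣ ≃* Sˣ) : φ (-1) = -1 := by
  have hz : (φ (-1) : S) * φ (-1) = 1 := by
    rw [← Units.val_mul, ← map_mul, neg_one_mul, neg_neg, map_one, Units.val_one]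
  rcases eq_one_or_neg_one_of_central (z := (φ (-1) : S)) hz
    (commute_map_of_central φ fun y => by
      rw [Units.val_neg, Units.val_one]
      exact (Commute.one_left y).neg_left) with h | h
  · exfalso
    have h1 : φ (-1) = φ 1 := by
      rw [map_one]
      exact Units.ext h
    have h2 := congrArg Units.val (φ.injective h1)
    rw [Units.val_neg, Units.val_one, neg_eq_iff_add_eq_zero, ← two_smul ℂ (1 : R)] at h2
    exact (smul_ne_zero two_ne_zero one_ne_zero) h2
  · exact Units.ext (by rw [h, Units.val_neg, Units.val_one])

lemma theta_one_sub (φ : Rˣ ≃* Sˣ) {e : R} (he : IsIdempotentElem e) :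
    theta φ (1 - e) = 1 - theta φ e := by
  rw [theta_of_isIdempotentElem φ he, theta_of_isIdempotentElem φ he.one_sub, symUnit_one_sub he,
    map_mul, map_neg_one_of_isSimpleRing, neg_one_mul, Units.val_neg]
  module

lemma theta_ne_one (φ : Rˣ ≃* Sˣ) {e : R} (he : IsIdempotentElem e) (he1 : e ≠ 1) :
    theta φ e ≠ 1 := by
  intro h
  refine theta_ne_zero φ he.one_sub (sub_ne_zero.2 he1.symm) ?_
  rw [theta_one_sub φ he, h, sub_self]

/-- The defining equation of coefficient maps, in terms of `θ(e)` only. -/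
lemma IsCoeffMaps.map_idemUnit {φ : Rˣ ≃* Sˣ} {e : R} {a b : ℂˣ →* ℂˣ}
    (h : IsCoeffMaps (⇑φ) e a b) (he : IsIdempotentElem e) (lam : ℂˣ) :
    (φ (idemUnit he lam) : S) =
      (a lam : ℂ) • theta φ e + (b lam : ℂ) • (1 - theta φ e) := by
  rw [h lam (idemUnit he lam) rfl, theta_one_sub φ he]

lemma IsCoeffMaps.eq_of_conj {φ : Rˣ ≃* Sˣ} {e f : R} {a b a' b' : ℂˣ →* ℂˣ}
    (hab : IsCoeffMaps (⇑φ) e a b) (hab' : IsCoeffMaps (⇑φ) f a' b') (he : IsIdempotentElem e)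
    (he0 : e ≠ 0) (he1 : e ≠ 1) (hf : IsIdempotentElem f) (u : Rˣ)
    (hfu : f = (u : R) * e * ((u⁻¹ : Rˣ) : R)) (lam : ℂˣ) : a lam = a' lam ∧ b lam = b' lam := by
  have hconj : idemUnit hf lam * u = u * idemUnit he lam := by
    ext
    simp only [idemUnit, Units.val_mul, hfu, mul_sub, sub_mul, mul_add, add_mul, mul_one, one_mul,
      mul_smul_comm, smul_mul_assoc, mul_assoc, Units.inv_mul]
  have htheta : theta φ f * (φ u : S) = (φ u : S) * theta φ e := by
    rw [theta_conj φ he hf u hfu, mul_assoc, Units.inv_mul, mul_one]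
  have hmap := congrArg (fun x => (φ x : S)) hconj
  simp only [map_mul, Units.val_mul, hab.map_idemUnit he, hab'.map_idemUnit hf, add_mul,
    smul_mul_assoc, sub_mul, one_mul, htheta] at hmap
  have h : (φ u : S) * ((a lam : ℂ) • theta φ e + (b lam : ℂ) • (1 - theta φ e)) =
      (φ u : S) * ((a' lam : ℂ) • theta φ e + (b' lam : ℂ) • (1 - theta φ e)) := by
    rw [← hmap]
    simp only [mul_add, mul_sub, mul_smul_comm, mul_one]
  obtain ⟨h1, h2⟩ := (isIdempotentElem_theta φ he).smul_add_smul_inj (theta_ne_zero φ he he0)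
    (theta_ne_one φ he he1) ((φ u).isUnit.mul_left_cancel h)
  exact ⟨Units.ext h1, Units.ext h2⟩

lemma IsCoeffMaps.sq_cOf_ne_one {R : Type*} [NormedRing R] [NormedAlgebra ℂ R] [CompleteSpace R]
    [IsSimpleRing R] {φ : Rˣ ≃* Sˣ} {e : R} {a b : ℂˣ →* ℂˣ}
    (hab : IsCoeffMaps (⇑φ) e a b) (he : IsIdempotentElem e) (he0 : e ≠ 0) (he1 : e ≠ 1)
    {lam : ℂˣ} (h1 : (lam : ℂ) ≠ 1) (h2 : (lam : ℂ) ≠ -1) : cOf a b lam ^ 2 ≠ 1 := by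
  intro hc
  have hsq : a (lam ^ 2) = b (lam ^ 2) := by
    rwa [cOf, mul_pow, inv_pow, mul_inv_eq_one, ← map_pow, ← map_pow] at hc
  have hmap : (φ (idemUnit he (lam ^ 2)) : S) = (a (lam ^ 2) : ℂ) • 1 := by
    rw [hab.map_idemUnit he, ← hsq]
    module
  have hcentral : ∀ y : R, Commute (idemUnit he (lam ^ 2) : R) y := by
    have h := commute_map_of_central φ.symm (u := φ (idemUnit he (lam ^ 2))) fun y => by
      rw [hmap]
      exact (Commute.one_left y).smul_left _
    rwa [MulEquiv.symm_apply_apply] at h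
  have hlam := eq_one_of_idemUnit_central he he0 he1 hcentral
  rw [Units.val_pow_eq_pow_val, sq_eq_one_iff] at hlam
  exact hlam.elim h1 h2

lemma IsCoeffMaps.cOf_one_sub {φ : Rˣ ≃* Sˣ} {e : R} {a b a' b' : ℂˣ →* ℂˣ}
    (hab : IsCoeffMaps (⇑φ) e a b) (hab' : IsCoeffMaps (⇑φ) (1 - e) a' b')
    (he : IsIdempotentElem e) (he0 : e ≠ 0) (he1 : e ≠ 1) (lam : ℂˣ) :
    cOf a b lam = cOf a' b' lam := by
  have hp := isIdempotentElem_theta φ he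
  have hmap : (φ (idemUnit he lam * idemUnit he.one_sub lam) : S) =
      ((a lam : ℂ) * b' lam) • theta φ e + ((b lam : ℂ) * a' lam) • (1 - theta φ e) := by
    rw [map_mul, Units.val_mul, hab.map_idemUnit he, hab'.map_idemUnit he.one_sub,
      theta_one_sub φ he, sub_sub_cancel]
    simp only [add_mul, mul_add, smul_mul_smul_comm, hp.eq, hp.one_sub.eq, hp.one_sub_mul_self,
      hp.mul_one_sub_self, smul_zero, zero_add, add_zero]
    exact add_comm _ _
  have h : (a lam : ℂ) * b' lam = (b lam : ℂ) * a' lam := by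
    refine hp.eq_of_smul_add_smul_central (theta_ne_zero φ he he0) (theta_ne_one φ he he1) ?_
    rw [← hmap]
    refine commute_map_of_central φ fun y => ?_
    rw [idemUnit_mul_one_sub]
    exact (Commute.one_left y).smul_left _
  have h' : a lam * b' lam = a' lam * b lam := by
    ext
    rw [Units.val_mul, Units.val_mul, h, mul_comm]
  rw [cOf, cOf, ← div_eq_mul_inv, ← div_eq_mul_inv, div_eq_div_iff_mul_eq_mul, h']

end Theta

theorem statement6 [IsSimpleRing A] [IsSimpleRing B] (φ : Aˣ ≃* Bˣ)
    (e : A) (he : IsIdempotentElem e) (he0 : e ≠ 0) (he1 : e ≠ 1)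
    (ae be : ℂˣ →* ℂˣ) (hab : IsCoeffMaps (⇑φ) e ae be) :
    (∀ f : A, IsIdempotentElem f → f ≠ 0 → f ≠ 1 →
      ∀ af bf : ℂˣ →* ℂˣ, IsCoeffMaps (⇑φ) f af bf →
        ∀ u : Aˣ, f = (u : A) * e * ((u⁻¹ : Aˣ) : A) →
          ∀ lam : ℂˣ, cOf ae be lam = cOf af bf lam) ∧
    (∀ lam : ℂˣ, (lam : ℂ) ≠ 1 → (lam : ℂ) ≠ -1 → (cOf ae be lam) ^ 2 ≠ 1) ∧
    (∀ a' b' : ℂˣ →* ℂˣ, IsCoeffMaps (⇑φ) (1 - e) a' b' →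
      ∀ lam : ℂˣ, cOf ae be lam = cOf a' b' lam) := by
  refine ⟨fun f hf _ _ af bf hf' u hfu lam => ?_, fun lam h1 h2 => ?_, fun a' b' h' lam => ?_⟩
  · obtain ⟨h1, h2⟩ := hab.eq_of_conj hf' he he0 he1 hf u hfu lam
    rw [cOf, cOf, h1, h2]
  · exact hab.sq_cOf_ne_one he he0 he1 h1 h2
  · exact hab.cOf_one_sub h' he he0 he1 lam

end
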